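/- Weierstraß condition (convexity of the Oseen–Frank density in the gradient variable): for all constants k₁,…,k₅ ≥ 0, every h ∈ ℝ³ and all matrices S, R ∈ ℝ^{3×3}, one has G(h,R) − G(h,S) ≥ F_S(h,S) : (R − S). -/

import Mathlib

open Matrix MeasureTheory
open scoped BigOperators

noncomputable section

/-- Kronecker delta on `Fin 3`. -/
def kd (i j : Fin 3) : ℝ := if i = j then 1 else 0

/-- Euclidean inner product on `ℝ³`. -/
def dot3 (a b : Fin 3 → ℝ) : ℝ := ∑ i, a i * b i

/-- Squared Euclidean norm on `ℝ³`. -/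
def normSq (a : Fin 3 → ℝ) : ℝ := ∑ i, (a i) ^ 2

/-- Cross product on `ℝ³`. -/
def cross3 (a b : Fin 3 → ℝ) : Fin 3 → ℝ :=
  ![a 1 * b 2 - a 2 * b 1, a 2 * b 0 - a 0 * b 2, a 0 * b 1 - a 1 * b 0]

/-- Outer product `a ⊗ b`. -/
def outer (a b : Fin 3 → ℝ) : Matrix (Fin 3) (Fin 3) ℝ := Matrix.of fun i j => a i * b j

/-- Symmetric part of a matrix. -/
def symPart (A : Matrix (Fin 3) (Fin 3) ℝ) : Matrix (Fin 3) (Fin 3) ℝ := (1 / 2 : ℝ) • (A + Aᵀ)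

/-- Skew-symmetric part of a matrix. -/
def skwPart (A : Matrix (Fin 3) (Fin 3) ℝ) : Matrix (Fin 3) (Fin 3) ℝ := (1 / 2 : ℝ) • (A - Aᵀ)

/-- Frobenius inner product `A : B = tr(Aᵀ B)`. -/
def frob (A B : Matrix (Fin 3) (Fin 3) ℝ) : ℝ := ∑ i, ∑ j, A i j * B i j

/-- Squared Frobenius norm. -/
def frobSq (A : Matrix (Fin 3) (Fin 3) ℝ) : ℝ := ∑ i, ∑ j, (A i j) ^ 2

/-- The hat map `[a]ₓ`, so that `[a]ₓ b = a × b`. -/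
def hatm (a : Fin 3 → ℝ) : Matrix (Fin 3) (Fin 3) ℝ :=
  !![0, -a 2, a 1; a 2, 0, -a 0; -a 1, a 0, 0]

/-- The vee map, left inverse of the hat map: `vee A = (A₃₂, A₁₃, A₂₁)`. -/
def vee (A : Matrix (Fin 3) (Fin 3) ℝ) : Fin 3 → ℝ := ![A 2 1, A 0 2, A 1 0]

/-- Entries of the fourth-order tensor `Λ`. -/
def lamE (k₁ k₂ : ℝ) (i j k l : Fin 3) : ℝ :=
  k₁ * kd i j * kd k l + k₂ * (kd i k * kd j l - kd i l * kd j k)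

/-- The contraction `S : Λ : T`. -/
def lamQ (k₁ k₂ : ℝ) (S T : Matrix (Fin 3) (Fin 3) ℝ) : ℝ :=
  ∑ i, ∑ j, ∑ k, ∑ l, S i j * lamE k₁ k₂ i j k l * T k l

/-- Entries of the sixth-order tensor `Θ`. -/
def thE (k₃ k₄ k₅ : ℝ) (i j k l m n : Fin 3) : ℝ :=
  k₃ * kd i j * kd l m * kd k n
    + k₅ * (kd i l * kd m n * kd j k - kd m i * kd l n * kd j k
        - kd l j * kd m n * kd i k + kd j m * kd l n * kd i k)
    + k₄ * (kd k n * kd j m * kd i l + kd k m * kd j l * kd i n + kd k l * kd j n * kd i m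
        - kd k n * kd j l * kd i m - kd k m * kd j n * kd i l - kd k l * kd j m * kd i n)

/-- The contraction `(S⊗h) : Θ : (S⊗h)`. -/
def thQ (k₃ k₄ k₅ : ℝ) (S : Matrix (Fin 3) (Fin 3) ℝ) (h : Fin 3 → ℝ) : ℝ :=
  ∑ i, ∑ j, ∑ k, ∑ l, ∑ m, ∑ n, thE k₃ k₄ k₅ i j k l m n * S i j * h k * S l m * h n

/-- Jacobian matrix of a vector field, `(∇f)_{ij} = ∂_j f_i`. -/
def jac (f : (Fin 3 → ℝ) → Fin 3 → ℝ) (x : Fin 3 → ℝ) : Matrix (Fin 3) (Fin 3) ℝ :=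
  Matrix.of fun i j => fderiv ℝ f x (Pi.single j 1) i

/-- Divergence of a vector field. -/
def divg (f : (Fin 3 → ℝ) → Fin 3 → ℝ) (x : Fin 3 → ℝ) : ℝ := ∑ i, jac f x i i

/-- Curl of a vector field. -/
def curl (f : (Fin 3 → ℝ) → Fin 3 → ℝ) (x : Fin 3 → ℝ) : Fin 3 → ℝ :=
  ![jac f x 2 1 - jac f x 1 2, jac f x 0 2 - jac f x 2 0, jac f x 1 0 - jac f x 0 1]

/-- Row-wise divergence of a matrix field, `(div A)_i = ∑_j ∂_j A_{ij}`. -/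
def matDiv (A : (Fin 3 → ℝ) → Matrix (Fin 3) (Fin 3) ℝ) (x : Fin 3 → ℝ) : Fin 3 → ℝ :=
  fun i => ∑ j, fderiv ℝ (fun y => A y i j) x (Pi.single j 1)

attribute [local instance] Matrix.normedAddCommGroup Matrix.normedSpace

/-- The Oseen–Frank energy density `F(h,S)`. -/
def Gdens (k₁ k₂ k₃ k₄ k₅ : ℝ) (h : Fin 3 → ℝ) (S : Matrix (Fin 3) (Fin 3) ℝ) : ℝ :=
  (1 / 2) * (k₁ * (Matrix.trace S) ^ 2 + k₂ * frobSq (skwPart S)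
    + k₃ * normSq h * (Matrix.trace S) ^ 2 + k₄ * frob (hatm h) (skwPart S) ^ 2
    + 4 * k₅ * normSq (Matrix.mulVec (skwPart S) h))

/-- The derivative `F_S(h,S)` of the energy density with respect to the gradient variable. -/
def FS (k₁ k₂ k₃ k₄ k₅ : ℝ) (h : Fin 3 → ℝ) (S : Matrix (Fin 3) (Fin 3) ℝ) :
    Matrix (Fin 3) (Fin 3) ℝ :=
  (k₁ * Matrix.trace S) • (1 : Matrix (Fin 3) (Fin 3) ℝ) + k₂ • skwPart S
    + (k₃ * Matrix.trace S * normSq h) • (1 : Matrix (Fin 3) (Fin 3) ℝ)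
    + (k₄ * frob (hatm h) (skwPart S)) • hatm h
    + (4 * k₅) • skwPart (outer (Matrix.mulVec (skwPart S) h) h)

/-- The gradient `F_h(h,S)` of the energy density with respect to the director variable. -/
def Fh (k₃ k₄ k₅ : ℝ) (h : Fin 3 → ℝ) (S : Matrix (Fin 3) (Fin 3) ℝ) : Fin 3 → ℝ :=
  (k₃ * (Matrix.trace S) ^ 2) • h
    + (2 * k₄ * frob (hatm h) (skwPart S)) • vee (skwPart S)
    + (4 * k₅) • Matrix.mulVec (skwPart S)ᵀ (Matrix.mulVec (skwPart S) h)

theorem normSq_nonneg (a : Fin 3 → ℝ) : 0 ≤ normSq a :=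
  Finset.sum_nonneg fun _ _ => sq_nonneg _

theorem frobSq_nonneg (A : Matrix (Fin 3) (Fin 3) ℝ) : 0 ≤ frobSq A :=
  Finset.sum_nonneg fun _ _ => Finset.sum_nonneg fun _ _ => sq_nonneg _

theorem Gdens_nonneg {k₁ k₂ k₃ k₄ k₅ : ℝ} (hk₁ : 0 ≤ k₁) (hk₂ : 0 ≤ k₂)
    (hk₃ : 0 ≤ k₃) (hk₄ : 0 ≤ k₄) (hk₅ : 0 ≤ k₅) (h : Fin 3 → ℝ)
    (S : Matrix (Fin 3) (Fin 3) ℝ) : 0 ≤ Gdens k₁ k₂ k₃ k₄ k₅ h S := by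
  have h₁ := normSq_nonneg h
  have h₂ := frobSq_nonneg (skwPart S)
  have h₃ := normSq_nonneg (Matrix.mulVec (skwPart S) h)
  unfold Gdens
  positivity

/-- The density is quadratic in the gradient variable, so its first-order Taylor remainder
at `S` is the density of the increment. -/
theorem Gdens_sub_sub_frob_FS (k₁ k₂ k₃ k₄ k₅ : ℝ) (h : Fin 3 → ℝ)
    (S R : Matrix (Fin 3) (Fin 3) ℝ) :
    Gdens k₁ k₂ k₃ k₄ k₅ h R - Gdens k₁ k₂ k₃ k₄ k₅ h S - frob (FS k₁ k₂ k₃ k₄ k₅ h S) (R - S)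
      = Gdens k₁ k₂ k₃ k₄ k₅ h (R - S) := by
  simp [Gdens, FS, frob, frobSq, normSq, skwPart, outer, hatm, Matrix.trace, Matrix.mulVec,
    dotProduct, Fin.sum_univ_three]
  ring

/-- Weierstraß condition: convexity of the Oseen–Frank density in the gradient variable,
`G(h,R) − G(h,S) ≥ F_S(h,S) : (R − S)` for nonnegative constants. -/
theorem weierstrass_condition (k₁ k₂ k₃ k₄ k₅ : ℝ) (hk₁ : 0 ≤ k₁) (hk₂ : 0 ≤ k₂)
    (hk₃ : 0 ≤ k₃) (hk₄ : 0 ≤ k₄) (hk₅ : 0 ≤ k₅) (h : Fin 3 → ℝ)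
    (S R : Matrix (Fin 3) (Fin 3) ℝ) :
    frob (FS k₁ k₂ k₃ k₄ k₅ h S) (R - S)
      ≤ Gdens k₁ k₂ k₃ k₄ k₅ h R - Gdens k₁ k₂ k₃ k₄ k₅ h S := by
  rw [← sub_nonneg, Gdens_sub_sub_frob_FS]
  exact Gdens_nonneg hk₁ hk₂ hk₃ hk₄ hk₅ h (R - S)
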